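/- arXiv:math/0207252 — 7 statements merged into one kernel-verified Lean document; each statement's English description precedes it below -/
import Mathlib

section
/- Let d : E¹ → E⁰ be a local homeomorphism between locally compact Hausdorff spaces. For any compact subset X of E¹ and any v ∈ E⁰, there exist an open neighborhood V of v and finitely many pairwise disjoint open sets U₁, …, U_n of E¹ such that for each k = 1, …, n the restriction of d to U_k is a homeomorphism onto V, and X ∩ d⁻¹(V) ⊆ U₁ ∪ ⋯ ∪ U_n. -/
open Set

/-- The fibres of a local homeomorphism meet compact sets in finite sets. -/
theorem IsLocalHomeomorph.finite_inter_fiber {X Y : Type*} [TopologicalSpace X]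
    [TopologicalSpace Y] [T1Space Y] {f : X → Y} (hf : IsLocalHomeomorph f) {K : Set X}
    (hK : IsCompact K) (y : Y) : (K ∩ f ⁻¹' {y}).Finite := by
  choose e he hfe using hf
  have hfiber : IsCompact (K ∩ f ⁻¹' {y}) :=
    hK.inter_right (isClosed_singleton.preimage (IsLocalHomeomorph.continuous
      fun x => ⟨e x, he x, hfe x⟩))
  obtain ⟨t, ht, hcover⟩ := hfiber.elim_nhds_subcover (fun x => (e x).source)
    fun x _ => (e x).open_source.mem_nhds (he x)
  refine t.finite_toSet.subset fun z hz => ?_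
  obtain ⟨x, hxt, hzx⟩ := mem_iUnion₂.1 (hcover hz)
  have hzx' : z = x := (e x).injOn hzx (he x) <| by
    rw [← hfe x]
    exact hz.2.trans (ht x hxt).2.symm
  exact hzx' ▸ hxt

/-- An open partial homeomorphism restricts to a homeomorphism from the preimage of a subset of
the image of `S` onto that subset. -/
theorem OpenPartialHomeomorph.exists_partialHomeomorph_onto {X Y : Type*} [TopologicalSpace X]
    [TopologicalSpace Y] (e : OpenPartialHomeomorph X Y) {S : Set X} (hS : S ⊆ e.source)
    {V : Set Y} (hV : V ⊆ e '' S) :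
    ∃ φ : PartialHomeomorph X Y,
      φ.source = S ∩ e ⁻¹' V ∧ φ.target = V ∧ EqOn e φ (S ∩ e ⁻¹' V) := by
  have hsymm : ∀ y ∈ V, e.symm y ∈ S ∧ e (e.symm y) = y := by
    intro y hy
    obtain ⟨x, hx, rfl⟩ := hV hy
    rw [e.left_inv (hS hx)]
    exact ⟨hx, rfl⟩
  have hVt : V ⊆ e.target := fun y hy => by
    obtain ⟨x, hx, rfl⟩ := hV hy
    exact e.map_source (hS hx)
  exact ⟨{ toFun := e
           invFun := e.symm
           source := S ∩ e ⁻¹' V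
           target := V
           map_source' := fun x hx => hx.2
           map_target' := fun y hy =>
             ⟨(hsymm y hy).1, by rw [mem_preimage, (hsymm y hy).2]; exact hy⟩
           left_inv' := fun x hx => e.left_inv (hS hx.1)
           right_inv' := fun y hy => (hsymm y hy).2
           continuousOn_toFun := e.continuousOn.mono fun x hx => hS hx.1
           continuousOn_invFun := e.symm.continuousOn.mono hVt },
    rfl, rfl, fun _ _ => rfl⟩


/-- Let `d : E¹ → E⁰` be a local homeomorphism between locally compact Hausdorff
spaces. For any compact subset `X` of `E¹` and any `v ∈ E⁰`, there exist an open
neighborhood `V` of `v` and finitely many pairwise disjoint open sets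
`U₁, …, U_n` of `E¹` such that for each `k` the restriction of `d` to `U k` is a
homeomorphism onto `V`, and `X ∩ d⁻¹(V) ⊆ U₁ ∪ ⋯ ∪ U_n`. -/
theorem stmt_1 {E0 E1 : Type*} [TopologicalSpace E0] [TopologicalSpace E1]
    [LocallyCompactSpace E0] [LocallyCompactSpace E1] [T2Space E0] [T2Space E1]
    {d : E1 → E0} (hd : IsLocalHomeomorph d)
    (X : Set E1) (hX : IsCompact X) (v : E0) :
    ∃ V : Set E0, IsOpen V ∧ v ∈ V ∧
      ∃ (n : ℕ) (U : Fin n → Set E1),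
        (∀ k, IsOpen (U k)) ∧
        (∀ k l, k ≠ l → Disjoint (U k) (U l)) ∧
        (∀ k, ∃ φ : PartialHomeomorph E1 E0,
          φ.source = U k ∧ φ.target = V ∧ Set.EqOn d φ (U k)) ∧
        X ∩ d ⁻¹' V ⊆ ⋃ k, U k := by
  have hF := hd.finite_inter_fiber hX v
  set F := X ∩ d ⁻¹' {v}
  obtain ⟨W, hW, hWdisj⟩ := hF.t2_separation
  choose e he hde using hd
  have hd : IsLocalHomeomorph d := fun x => ⟨e x, he x, hde x⟩
  let S : E1 → Set E1 := fun x => W x ∩ (e x).source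
  have hSo : ∀ x, IsOpen (S x) := fun x => (hW x).2.inter (e x).open_source
  have hK : IsCompact (X \ ⋃ x ∈ F, S x) := hX.diff (isOpen_biUnion fun x _ => hSo x)
  let V : Set E0 := (d '' (X \ ⋃ x ∈ F, S x))ᶜ ∩ ⋂ x ∈ F, d '' S x
  have hVo : IsOpen V := (hK.image hd.continuous).isClosed.isOpen_compl.inter
    (hF.isOpen_biInter fun x _ => hd.isOpenMap _ (hSo x))
  have hVS : ∀ x ∈ F, V ⊆ d '' S x := fun x hx y hy => mem_iInter₂.1 hy.2 x hx
  have hvV : v ∈ V := by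
    refine ⟨?_, mem_iInter₂.2 fun x hx => ⟨x, ⟨(hW x).1, he x⟩, hx.2⟩⟩
    rintro ⟨x, ⟨hxX, hxS⟩, hxv⟩
    exact hxS (mem_iUnion₂.2 ⟨x, ⟨hxX, hxv⟩, (hW x).1, he x⟩)
  have : Finite F := hF
  let i := Finite.equivFin F
  refine ⟨V, hVo, hvV, Nat.card F, fun k => S (i.symm k) ∩ d ⁻¹' V,
    fun k => (hSo _).inter (hVo.preimage hd.continuous), fun k l hkl => ?_, fun k => ?_, ?_⟩
  · have hne : (i.symm k : E1) ≠ i.symm l := fun h =>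
      hkl (i.symm.injective (Subtype.ext h))
    exact (hWdisj (i.symm k).2 (i.symm l).2 hne).mono (fun _ h => h.1.1) fun _ h => h.1.1
  · have := (e (i.symm k)).exists_partialHomeomorph_onto (S := S (i.symm k)) (V := V)
      inter_subset_right (by rw [← hde]; exact hVS _ (i.symm k).2)
    rwa [← hde] at this
  · rintro x ⟨hxX, hxV⟩
    by_contra hx
    refine hxV.1 ⟨x, ⟨hxX, fun hxS => hx ?_⟩, rfl⟩
    obtain ⟨z, hzF, hxz⟩ := mem_iUnion₂.1 hxS
    exact mem_iUnion.2 ⟨i ⟨z, hzF⟩, by rwa [i.symm_apply_apply], hxV⟩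
end

section
/- For every f ∈ C_c(E¹) there exist finitely many ξ₁, …, ξ_m, η₁, …, η_m ∈ C_c(E¹) such that f = Σ_{k=1}^m ξ_k · conj(η_k) pointwise, and such that for every k and all e, e' ∈ E¹ with e ≠ e' and d(e) = d(e'), one has ξ_k(e)·conj(η_k(e')) = 0. -/
/-- For every `f ∈ C_c(E¹)` there exist finitely many
`ξ₁, …, ξ_m, η₁, …, η_m ∈ C_c(E¹)` such that `f = Σ_k ξ_k · conj(η_k)`
pointwise, and such that for every `k` and all `e ≠ e'` with `d(e) = d(e')`,
one has `ξ_k(e)·conj(η_k(e')) = 0`. -/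
theorem stmt_8 {E0 E1 : Type*} [TopologicalSpace E0] [TopologicalSpace E1]
    [LocallyCompactSpace E0] [LocallyCompactSpace E1] [T2Space E0] [T2Space E1]
    {d : E1 → E0} (hd : IsLocalHomeomorph d)
    (f : E1 → ℂ) (hf : Continuous f) (hfc : HasCompactSupport f) :
    ∃ (m : ℕ) (ξ η : Fin m → E1 → ℂ),
      (∀ k, Continuous (ξ k) ∧ HasCompactSupport (ξ k)) ∧
      (∀ k, Continuous (η k) ∧ HasCompactSupport (η k)) ∧
      (∀ e : E1, f e = ∑ k, ξ k e * (starRingEnd ℂ) (η k e)) ∧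
      (∀ k, ∀ e e' : E1, e ≠ e' → d e = d e' →
        ξ k e * (starRingEnd ℂ) (η k e') = 0) := by
  choose φ hφ hdφ using hd
  obtain ⟨t, ht⟩ := hfc.isCompact.elim_finite_subcover (fun x : E1 => (φ x).source)
    (fun x => (φ x).open_source) (fun x _ => Set.mem_iUnion.mpr ⟨x, hφ x⟩)
  obtain ⟨g, hgU, hg1, hg01, hgc⟩ := exists_continuous_sum_one_of_isOpen_isCompact
    (s := fun k : Fin t.card => (φ (t.equivFin.symm k)).source)
    (fun _ => (φ _).open_source) hfc.isCompact (by
      intro x hx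
      obtain ⟨i, hi, hxi⟩ := Set.mem_iUnion₂.mp (ht hx)
      exact Set.mem_iUnion.mpr ⟨t.equivFin ⟨i, hi⟩, by simpa using hxi⟩)
  have hcont : ∀ k, Continuous fun x => (√(g k x) : ℂ) := fun k => by fun_prop
  have hcomp : ∀ k, HasCompactSupport fun x => (√(g k x) : ℂ) := fun k =>
    (hgc k).comp_left (g := fun r : ℝ => (√r : ℂ)) (by simp)
  refine ⟨t.card, fun k x => f x * (√(g k x) : ℂ), fun k x => (√(g k x) : ℂ),
    fun k => ⟨hf.mul (hcont k), hfc.mul_right⟩, fun k => ⟨hcont k, hcomp k⟩, fun e => ?_, ?_⟩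
  · have hsq : ∀ k, f e * (√(g k e) : ℂ) * starRingEnd ℂ (√(g k e) : ℂ) = f e * (g k e : ℂ) := by
      intro k
      rw [Complex.conj_ofReal, mul_assoc, ← Complex.ofReal_mul, Real.mul_self_sqrt (hg01 k e).1]
    simp only [hsq, ← Finset.mul_sum]
    by_cases he : e ∈ tsupport f
    · have hsum : ∑ k, g k e = 1 := by simpa using hg1 he
      rw [← Complex.ofReal_sum, hsum, Complex.ofReal_one, mul_one]
    · simp [image_eq_zero_of_notMem_tsupport he]
  · intro k e e' hne hde
    have hsource : ∀ x, g k x ≠ 0 → x ∈ (φ (t.equivFin.symm k)).source := fun x hx =>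
      hgU k (subset_tsupport _ hx)
    by_cases h : g k e = 0
    · simp [h]
    by_cases h' : g k e' = 0
    · simp [h']
    refine absurd ((φ _).injOn (hsource e h) (hsource e' h') ?_) hne
    rwa [← hdφ]
end

section
/- Let E = (E⁰, E¹, d, r) be a topological graph. For v ∈ E⁰ one has v ∈ E⁰_rg if and only if there exists a neighborhood V of v such that r⁻¹(V) is compact and r(r⁻¹(V)) = V. -/
/-- The set of regular vertices `E⁰_rg = E⁰_fin \ closure(E⁰_sce)` of a
topological graph `(E⁰, E¹, d, r)`, where `E⁰_sce = E⁰ \ closure(r(E¹))` and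
`E⁰_fin = {v : v has a neighborhood V with r⁻¹(V) compact}`. -/
def regularVertices {E0 E1 : Type*} [TopologicalSpace E0] [TopologicalSpace E1]
    (r : E1 → E0) : Set E0 :=
  {v : E0 | ∃ V ∈ nhds v, IsCompact (r ⁻¹' V)} \
    closure ((closure (Set.range r))ᶜ)

/-- Let `E = (E⁰, E¹, d, r)` be a topological graph.  For `v ∈ E⁰` one has
`v ∈ E⁰_rg` if and only if there exists a neighborhood `V` of `v` such that
`r⁻¹(V)` is compact and `r(r⁻¹(V)) = V`. -/
theorem stmt_13 {E0 E1 : Type*} [TopologicalSpace E0] [TopologicalSpace E1]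
    [LocallyCompactSpace E0] [LocallyCompactSpace E1] [T2Space E0] [T2Space E1]
    {d : E1 → E0} (hd : IsLocalHomeomorph d)
    {r : E1 → E0} (hr : Continuous r) (v : E0) :
    v ∈ regularVertices r ↔
      ∃ V ∈ nhds v, IsCompact (r ⁻¹' V) ∧ r '' (r ⁻¹' V) = V := by
  have key : v ∉ closure ((closure (Set.range r))ᶜ) ↔ closure (Set.range r) ∈ nhds v := by
    rw [closure_compl, Set.notMem_compl_iff, mem_interior_iff_mem_nhds]
  constructor
  · rintro ⟨⟨V, hV, hc⟩, hv⟩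
    have hK : IsClosed (r '' (r ⁻¹' V)) := (hc.image hr).isClosed
    have hpre : r ⁻¹' (r '' (r ⁻¹' V)) = r ⁻¹' V := Set.preimage_image_preimage
    refine ⟨r '' (r ⁻¹' V), ?_, by rwa [hpre], by rw [hpre]⟩
    filter_upwards [interior_mem_nhds.2 hV, key.1 hv] with w hwV hw
    have hsub : interior V ∩ Set.range r ⊆ r '' (r ⁻¹' V) := by
      rw [Set.image_preimage_eq_inter_range]
      exact Set.inter_subset_inter_left _ interior_subset
    exact closure_minimal hsub hK (isOpen_interior.inter_closure ⟨hwV, hw⟩)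
  · rintro ⟨V, hV, hc, hVr⟩
    refine ⟨⟨V, hV, hc⟩, key.2 (Filter.mem_of_superset hV ?_)⟩
    rw [← hVr]
    exact (Set.image_subset_range r _).trans subset_closure
end

section
/- Let E = (E⁰, E¹, d, r) be a topological graph. Then: (1) the restriction of r to r⁻¹(E⁰_rg), viewed as a map onto E⁰_rg, is surjective and proper in the sense that the preimage of every compact subset of E⁰_rg is compact; and (2) E⁰_rg is the largest such open set: if U ⊆ E⁰ is open, r(r⁻¹(U)) = U, and r⁻¹(K) is compact for every compact K ⊆ U, then U ⊆ E⁰_rg. -/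
/-- Let `E = (E⁰, E¹, d, r)` be a topological graph.  Then (1) `E⁰_rg` is open,
the restriction of `r` to `r⁻¹(E⁰_rg)` is a surjection onto `E⁰_rg` which is
proper in the sense that the preimage of every compact subset of `E⁰_rg` is
compact; and (2) `E⁰_rg` is the largest such open set. -/
theorem stmt_14 {E0 E1 : Type*} [TopologicalSpace E0] [TopologicalSpace E1]
    [LocallyCompactSpace E0] [LocallyCompactSpace E1] [T2Space E0] [T2Space E1]
    {d : E1 → E0} (hd : IsLocalHomeomorph d)
    {r : E1 → E0} (hr : Continuous r) :
    IsOpen (regularVertices r) ∧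
    r '' (r ⁻¹' regularVertices r) = regularVertices r ∧
    (∀ K : Set E0, K ⊆ regularVertices r → IsCompact K → IsCompact (r ⁻¹' K)) ∧
    (∀ U : Set E0, IsOpen U → r '' (r ⁻¹' U) = U →
      (∀ K : Set E0, K ⊆ U → IsCompact K → IsCompact (r ⁻¹' K)) →
      U ⊆ regularVertices r) := by
  refine ⟨?_, ?_, ?_, ?_⟩
  · refine IsOpen.sdiff (isOpen_iff_mem_nhds.2 ?_) isClosed_closure
    rintro v ⟨V, hV, hc⟩
    filter_upwards [eventually_mem_nhds_iff.2 hV] with w hw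
    exact ⟨V, hw, hc⟩
  · refine Set.image_preimage_eq_of_subset ?_
    rintro v ⟨⟨V, hV, hc⟩, hv⟩
    have hv' : v ∈ closure (Set.range r) := by
      by_contra h
      exact hv (subset_closure h)
    have hcl : IsClosed (r '' (r ⁻¹' V)) := (hc.image hr).isClosed
    rw [Set.image_preimage_eq_inter_range] at hcl
    have hmem : v ∈ closure (V ∩ Set.range r) := by
      rw [mem_closure_iff_nhds] at hv' ⊢
      intro t ht
      rw [← Set.inter_assoc]
      exact hv' _ (Filter.inter_mem ht hV)
    exact (hcl.closure_eq ▸ hmem).2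
  · intro K hK hKc
    obtain ⟨t, hKt, ht⟩ : ∃ t, K ⊆ t ∧ IsCompact (r ⁻¹' t) := by
      refine hKc.induction_on (p := fun s => ∃ t, s ⊆ t ∧ IsCompact (r ⁻¹' t)) ?_ ?_ ?_ ?_
      · exact ⟨∅, subset_rfl, by simp⟩
      · rintro s s' hs ⟨t, hst, ht⟩
        exact ⟨t, hs.trans hst, ht⟩
      · rintro s s' ⟨t, hst, ht⟩ ⟨t', hst', ht'⟩
        exact ⟨t ∪ t', Set.union_subset_union hst hst', ht.union ht'⟩
      · intro x hx
        obtain ⟨V, hV, hc⟩ := (hK hx).1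
        exact ⟨V, mem_nhdsWithin_of_mem_nhds hV, V, subset_rfl, hc⟩
    exact ht.of_isClosed_subset (hKc.isClosed.preimage hr) (Set.preimage_mono hKt)
  · intro U hU hUr hUc v hv
    have hUR : U ⊆ closure (Set.range r) :=
      (Set.image_preimage_eq_iff.1 hUr).trans subset_closure
    obtain ⟨K, hK, hKU, hKc⟩ := local_compact_nhds (hU.mem_nhds hv)
    refine ⟨⟨K, hK, hUc K hKU hKc⟩, ?_⟩
    rw [closure_compl, Set.mem_compl_iff, not_not]
    exact interior_maximal hUR hU hv
end

section
/- Let r : E¹ → F⁰ be a continuous map between locally compact Hausdorff spaces. For f ∈ C₀(F⁰): (1) f ∘ r is identically zero on E¹ if and only if f vanishes on closure(r(E¹)) (equivalently, f ∈ C₀(F⁰_sce)); and (2) f ∘ r ∈ C₀(E¹) (i.e. f ∘ r vanishes at infinity on E¹) if and only if f vanishes outside F⁰_fin (equivalently, f ∈ C₀(F⁰_fin)). -/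
open scoped Topology

/-- Let `r : E¹ → F⁰` be a continuous map between locally compact Hausdorff
spaces.  For `f ∈ C₀(F⁰)`: (1) `f ∘ r ≡ 0` on `E¹` iff `f` vanishes on
`closure(r(E¹))` (i.e. `f ∈ C₀(F⁰_sce)`); and (2) `f ∘ r` vanishes at infinity
on `E¹` iff `f` vanishes outside `F⁰_fin` (i.e. `f ∈ C₀(F⁰_fin)`), where
`F⁰_fin = {v : v has a neighborhood V with r⁻¹(V) compact}`. -/
theorem stmt_16 {E1 F0 : Type*} [TopologicalSpace E1] [TopologicalSpace F0]
    [LocallyCompactSpace E1] [LocallyCompactSpace F0] [T2Space E1] [T2Space F0]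
    {r : E1 → F0} (hr : Continuous r)
    (f : F0 → ℂ) (hf : Continuous f)
    (hf0 : Filter.Tendsto f (Filter.cocompact F0) (𝓝 0)) :
    ((∀ e : E1, f (r e) = 0) ↔ (∀ v ∈ closure (Set.range r), f v = 0)) ∧
    (Filter.Tendsto (fun e : E1 => f (r e)) (Filter.cocompact E1) (𝓝 0) ↔
      (∀ v : F0, v ∉ {v : F0 | ∃ V ∈ nhds v, IsCompact (r ⁻¹' V)} → f v = 0)) := by
  refine ⟨⟨fun h v hv => ?_, fun h e => h _ (subset_closure ⟨e, rfl⟩)⟩,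
    fun h v hv => ?_, fun h => ?_⟩
  · have hclosed : IsClosed {v | f v = 0} := isClosed_eq hf continuous_const
    exact closure_minimal (Set.range_subset_iff.2 h) hclosed hv
  · by_contra hne
    have hpos : 0 < ‖f v‖ := norm_pos_iff.2 hne
    refine hv ⟨{w | ‖f v‖ / 2 ≤ ‖f w‖}, ?_, ?_⟩
    · filter_upwards [hf.norm.continuousAt.eventually (lt_mem_nhds (half_lt_self hpos))]
        with w hw using hw.le
    · obtain ⟨K, hK, hKs⟩ := Filter.mem_cocompact.1
        (h (Metric.ball_mem_nhds 0 (half_pos hpos)))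
      refine hK.of_isClosed_subset
        ((isClosed_le continuous_const hf.norm).preimage hr) fun e he => ?_
      by_contra heK
      have hlt : ‖f (r e)‖ < ‖f v‖ / 2 := by simpa using hKs heK
      exact absurd hlt (not_lt.2 he)
  · rw [Metric.tendsto_nhds]
    intro ε hε
    obtain ⟨K, hK, hKs⟩ := Filter.mem_cocompact.1 (hf0 (Metric.ball_mem_nhds 0 hε))
    have hL : IsCompact {w | ε ≤ ‖f w‖} := by
      refine hK.of_isClosed_subset (isClosed_le continuous_const hf.norm) fun w hw => ?_
      by_contra hwK
      have hlt : ‖f w‖ < ε := by simpa using hKs hwK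
      exact absurd hlt (not_lt.2 hw)
    obtain ⟨T, hT, hLT⟩ : ∃ T, IsCompact T ∧ r ⁻¹' {w | ε ≤ ‖f w‖} ⊆ T := by
      refine hL.induction_on (p := fun s => ∃ T, IsCompact T ∧ r ⁻¹' s ⊆ T)
        ⟨∅, isCompact_empty, by simp⟩ ?_ ?_ ?_
      · rintro s t hst ⟨T, hT, htT⟩
        exact ⟨T, hT, (Set.preimage_mono hst).trans htT⟩
      · rintro s t ⟨S, hS, hsS⟩ ⟨T, hT, htT⟩
        exact ⟨S ∪ T, hS.union hT, Set.union_subset_union hsS htT⟩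
      · intro v hv
        have hne : f v ≠ 0 := norm_pos_iff.1 (hε.trans_le hv)
        obtain ⟨V, hV, hVc⟩ := not_imp_comm.1 (h v) hne
        exact ⟨V, mem_nhdsWithin_of_mem_nhds hV, _, hVc, subset_rfl⟩
    filter_upwards [hT.compl_mem_cocompact] with e he
    rw [dist_zero_right]
    exact not_le.1 fun hle => he (hLT hle)
end

section
/- Let E = (E⁰, E¹, d, r) be a topological graph, let V be an open subset of E⁰, and let e = (e_n, …, e_1) ∈ E^n (n ≥ 1) be a non-returning path with r^n(e) ∈ V. Then there exists a non-empty open subset U of E^n with U ⊆ (r^n)⁻¹(V) such that U is non-returning. -/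
/-- `p : Fin (n+1) → E¹` is a path of length `n+1` in the topological graph
`(E⁰, E¹, d, r)` (written `(e_{n+1}, …, e_1)` in the paper, with
`p 0 = e_1, …, p (Fin.last n) = e_{n+1}`): consecutive edges are composable,
`d(e_{k+1}) = r(e_k)`. -/
def IsPath {E0 E1 : Type*} (d r : E1 → E0) (n : ℕ) (p : Fin (n + 1) → E1) : Prop :=
  ∀ i : Fin n, d (p i.succ) = r (p i.castSucc)

/-- Let `E = (E⁰, E¹, d, r)` be a topological graph, `V ⊆ E⁰` open, and let
`p ∈ E^{n+1}` be a non-returning path with `r^{n+1}(p) ∈ V`.  Then there exists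
a non-empty open subset `U` of `E^{n+1}` (realized as the trace on the path
space of an open set of `(E¹)^{n+1}`) contained in `(r^{n+1})⁻¹(V)` which is
non-returning. -/
theorem stmt_17 {E0 E1 : Type*} [TopologicalSpace E0] [TopologicalSpace E1]
    [LocallyCompactSpace E0] [LocallyCompactSpace E1] [T2Space E0] [T2Space E1]
    {d : E1 → E0} (hd : IsLocalHomeomorph d)
    {r : E1 → E0} (hr : Continuous r)
    (V : Set E0) (hV : IsOpen V)
    (n : ℕ) (p : Fin (n + 1) → E1) (hp : IsPath d r n p)
    (hnonret : ∀ i : Fin (n + 1), i ≠ 0 → p i ≠ p 0)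
    (hrange : r (p (Fin.last n)) ∈ V) :
    ∃ U : Set {q : Fin (n + 1) → E1 // IsPath d r n q},
      IsOpen U ∧ U.Nonempty ∧
      (∀ q ∈ U, r (q.1 (Fin.last n)) ∈ V) ∧
      (∀ q ∈ U, ∀ q' ∈ U, ∀ i : Fin (n + 1), i ≠ 0 → q.1 0 ≠ q'.1 i) := by
  have hsep : ∀ i : Fin (n + 1), ∃ A B : Set E1, IsOpen A ∧ IsOpen B ∧ p 0 ∈ A ∧ p i ∈ B ∧
      (i ≠ 0 → Disjoint A B) := by
    intro i
    by_cases hi : i = 0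
    · exact ⟨Set.univ, Set.univ, isOpen_univ, isOpen_univ, trivial, trivial, fun h => absurd hi h⟩
    · obtain ⟨A, B, hA, hB, h0, h1, hAB⟩ := t2_separation (hnonret i hi).symm
      exact ⟨A, B, hA, hB, h0, h1, fun _ => hAB⟩
  choose A B hA hB hpA hpB hAB using hsep
  have hcoord : ∀ i : Fin (n + 1),
      Continuous fun q : {q : Fin (n + 1) → E1 // IsPath d r n q} => q.1 i :=
    fun i => (continuous_apply i).comp continuous_subtype_val
  refine ⟨{q | r (q.1 (Fin.last n)) ∈ V} ∩ ⋂ i, {q | q.1 0 ∈ A i} ∩ {q | q.1 i ∈ B i},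
    ?_, ⟨⟨p, hp⟩, hrange, Set.mem_iInter.2 fun i => ⟨hpA i, hpB i⟩⟩, fun q hq => hq.1, ?_⟩
  · exact (hV.preimage (hr.comp (hcoord _))).inter <| isOpen_iInter_of_finite fun i =>
      ((hA i).preimage (hcoord 0)).inter ((hB i).preimage (hcoord i))
  · intro q hq q' hq' i hi
    exact (hAB i hi).ne_of_mem (Set.mem_iInter.1 hq.2 i).1 (Set.mem_iInter.1 hq'.2 i).2
end

section
/- Let E = (E⁰, E¹, d, r) be a topologically free topological graph. Then for every open subset V of E⁰ and every positive integer n, either (r^n)⁻¹(V) = ∅, or there exist an integer m ≥ n and a non-returning path e ∈ E^m with r^m(e) ∈ V. -/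
/-- The set of base points of loops without entrances: vertices `v` which are
the base point `r^{m}(p) = d^{m}(p)` of some loop `p` all of whose edges `p i`
satisfy `r⁻¹(r(p i)) = {p i}`. -/
def loopNoEntranceBase {E0 E1 : Type*} (d r : E1 → E0) : Set E0 :=
  {v : E0 | ∃ (n : ℕ) (p : Fin (n + 1) → E1), IsPath d r n p ∧
    r (p (Fin.last n)) = d (p 0) ∧
    (∀ i : Fin (n + 1), ∀ e : E1, r e = r (p i) → e = p i) ∧
    v = d (p 0)}

/-- `IsWalk d r v l w` says that the edges of `l`, listed in the order `[e_m, …, e_1]`, form a path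
`(e_m, …, e_1)` with range `v` and source `w`; the empty list is the path of length `0` at `v`. -/
def IsWalk {E0 E1 : Type*} (d r : E1 → E0) : E0 → List E1 → E0 → Prop
  | v, [], w => v = w
  | v, x :: l, w => r x = v ∧ IsWalk d r (d x) l w

namespace IsWalk

variable {E0 E1 : Type*} {d r : E1 → E0}

theorem append_iff {u w : E0} {l₁ l₂ : List E1} :
    IsWalk d r u (l₁ ++ l₂) w ↔ ∃ v, IsWalk d r u l₁ v ∧ IsWalk d r v l₂ w := by
  induction l₁ generalizing u with
  | nil => simp [IsWalk]
  | cons x l ih => simp [IsWalk, ih, and_assoc]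

theorem append {u v w : E0} {l₁ l₂ : List E1} (h₁ : IsWalk d r u l₁ v)
    (h₂ : IsWalk d r v l₂ w) : IsWalk d r u (l₁ ++ l₂) w :=
  append_iff.2 ⟨v, h₁, h₂⟩

theorem singleton (y : E1) : IsWalk d r (r y) [y] (d y) := ⟨rfl, rfl⟩

/-- A nonempty walk yields a path in the sense of `IsPath`. -/
theorem exists_isPath {v w : E0} {l : List E1} {y : E1} (h : IsWalk d r v (l ++ [y]) w) :
    ∃ p : Fin (l.length + 1) → E1, IsPath d r l.length p ∧ r (p (Fin.last _)) = v ∧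
      d (p 0) = w ∧ p 0 = y ∧ ∀ i, i ≠ 0 → p i ∈ l := by
  induction l generalizing v with
  | nil =>
    obtain ⟨h₁, h₂⟩ := h
    exact ⟨fun _ => y, fun i => i.elim0, h₁, h₂, rfl, fun i hi => (hi (Fin.fin_one_eq_zero i)).elim⟩
  | cons x l ih =>
    obtain ⟨h₁, h₂⟩ := h
    obtain ⟨p, hp, hr, hd, hy, hl⟩ := ih h₂
    have h0 : (Fin.snoc p x : Fin (l.length + 1 + 1) → E1) 0 = p 0 :=
      Fin.snoc_castSucc (α := fun _ => E1) x p 0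
    refine ⟨(Fin.snoc p x : Fin (l.length + 1 + 1) → E1), ?_, ?_, ?_, ?_, ?_⟩
    · intro i
      induction i using Fin.lastCases with
      | last => simp [hr]
      | cast i =>
        rw [Fin.succ_castSucc, Fin.snoc_castSucc, Fin.snoc_castSucc]
        exact hp i
    · simpa using h₁
    · rw [h0, hd]
    · rw [h0, hy]
    · intro i
      induction i using Fin.lastCases with
      | last => simp
      | cast i =>
        intro hi
        rw [Fin.snoc_castSucc]
        exact List.mem_cons_of_mem _ (hl i (by rintro rfl; exact hi rfl))

/-- Going around a nonempty closed walk repeatedly gives arbitrarily long closed walks. -/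
theorem exists_le_length {u : E0} {q : List E1} (hq : IsWalk d r u q u) (hne : q ≠ []) (k : ℕ) :
    ∃ q', IsWalk d r u q' u ∧ k ≤ q'.length ∧ ∀ e ∈ q', e ∈ q := by
  induction k with
  | zero => exact ⟨q, hq, Nat.zero_le _, fun _ => id⟩
  | succ k ih =>
    obtain ⟨q', h, hk, hmem⟩ := ih
    have := List.length_pos_iff.2 hne
    refine ⟨q ++ q', hq.append h, by rw [List.length_append]; omega, fun e he => ?_⟩
    exact (List.mem_append.1 he).elim id (hmem e)

/-- In a shortest nonempty closed walk, two edges with the same range are equal. -/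
theorem eq_of_range_eq {w : E0} {a b : List E1} {x y : E1}
    (hc : IsWalk d r w (a ++ x :: b) w)
    (hmin : ∀ c, c ≠ [] → IsWalk d r w c w → (a ++ x :: b).length ≤ c.length)
    (hy : y ∈ a ++ x :: b) (hxy : r y = r x) : y = x := by
  obtain ⟨u, ha, hxu, hb⟩ := append_iff.1 hc
  rcases List.mem_append.1 hy with hy | hy
  · obtain ⟨a₁, a₂, rfl⟩ := List.append_of_mem hy
    obtain ⟨u', ha₁, hyu, -⟩ := append_iff.1 ha
    have := hmin (a₁ ++ x :: b) (by simp) (ha₁.append ⟨by rw [← hxy, hyu], hb⟩)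
    simp at this
    omega
  · rcases List.mem_cons.1 hy with hy | hy
    · exact hy
    · obtain ⟨b₁, b₂, rfl⟩ := List.append_of_mem hy
      obtain ⟨u', -, -, hb₂⟩ := append_iff.1 hb
      have := hmin (a ++ y :: b₂) (by simp) (ha.append ⟨by rw [hxy, hxu], hb₂⟩)
      simp at this
      omega

/-- If all walks of length greater than `n` starting in `V` are returning, then the sources of such
walks are base points of loops without entrances. -/
theorem mem_loopNoEntranceBase {V : Set E0} {n : ℕ}
    (H : ∀ v ∈ V, ∀ l y w, IsWalk d r v (l ++ [y]) w → n ≤ l.length → y ∈ l)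
    {v w : E0} (hv : v ∈ V) {l : List E1} (hl : l.length = n + 1) (h : IsWalk d r v l w) :
    w ∈ loopNoEntranceBase d r := by
  have hex : ∃ k c, c ≠ [] ∧ IsWalk d r w c w ∧ c.length = k := by
    obtain ⟨l', y, rfl⟩ := List.eq_nil_or_concat' l |>.resolve_left (by rintro rfl; simp at hl)
    obtain ⟨a, b, rfl⟩ := List.append_of_mem (H v hv l' y w h (by simp at hl ⊢; omega))
    obtain ⟨u, h₁, hyu, hyw⟩ := append_iff.1 h
    obtain ⟨u', -, -, hb⟩ := append_iff.1 h₁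
    have hdy : d y = w := hyw
    have hloop : IsWalk d r (d y) (b ++ [y]) w := hb.append ⟨hyu, hyw⟩
    exact ⟨_, b ++ [y], by simp, hdy ▸ hloop, rfl⟩
  classical
  obtain ⟨c, hne, hc, hlen⟩ := Nat.find_spec hex
  have hmin : ∀ c', c' ≠ [] → IsWalk d r w c' w → c.length ≤ c'.length := fun c' h₁ h₂ =>
    hlen ▸ Nat.find_min' hex ⟨c', h₁, h₂, rfl⟩
  have huniq : ∀ x ∈ c, ∀ y, r y = r x → y = x := by
    intro x hx y hyx
    obtain ⟨a, b, rfl⟩ := List.append_of_mem hx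
    by_contra hne'
    have hyc : y ∉ a ++ x :: b := fun hy => hne' (eq_of_range_eq hc hmin hy hyx)
    obtain ⟨u, ha, rfl, hb⟩ := append_iff.1 hc
    have hyl : y ∈ l := by
      have := H v hv (l ++ a) y (d y) ((h.append ha).append ⟨hyx, rfl⟩)
        (by rw [List.length_append]; omega)
      exact (List.mem_append.1 this).resolve_right fun hya => hyc (List.mem_append_left _ hya)
    obtain ⟨l₁, l₂, rfl, hyl₁⟩ := List.eq_append_cons_of_mem hyl
    obtain ⟨u', hl₁, rfl, -⟩ := append_iff.1 h
    have hq : IsWalk d r (r x) (x :: b ++ a) (r x) :=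
      IsWalk.append (v := w) ⟨rfl, hb⟩ ha
    obtain ⟨q, hq, hn, hmem⟩ := hq.exists_le_length (by simp) n
    rw [← hyx] at hq
    have := H v hv (l₁ ++ q) y (d y) ((hl₁.append hq).append (singleton y))
      (by rw [List.length_append]; omega)
    rcases List.mem_append.1 this with hy | hy
    · exact hyl₁ hy
    · have := hmem y hy
      simp only [List.mem_append, List.mem_cons] at this hyc
      tauto
  obtain ⟨c', y, rfl⟩ := (List.eq_nil_or_concat' c).resolve_left hne
  obtain ⟨p, hp, hr, hd, hy, hmem⟩ := hc.exists_isPath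
  refine ⟨_, p, hp, hr.trans hd.symm, fun i e he => huniq (p i) ?_ e he, hd.symm⟩
  by_cases hi : i = 0
  · simp [hi, hy]
  · exact List.mem_append_left _ (hmem i hi)

/-- The sources of walks of length `k` starting in an open set form an open set. -/
theorem isOpen_sources [TopologicalSpace E0] [TopologicalSpace E1] (hd : IsOpenMap d)
    (hr : Continuous r) {V : Set E0} (hV : IsOpen V) (k : ℕ) :
    IsOpen {w | ∃ v ∈ V, ∃ l : List E1, l.length = k ∧ IsWalk d r v l w} := by
  induction k with
  | zero => simpa [IsWalk] using hV
  | succ k ih =>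
    convert hd _ (ih.preimage hr) using 1
    ext w
    constructor
    · rintro ⟨v, hv, l, hl, h⟩
      obtain ⟨l', y, rfl⟩ := List.eq_nil_or_concat' l |>.resolve_left (by rintro rfl; simp at hl)
      obtain ⟨u, h₁, rfl, rfl⟩ := append_iff.1 h
      exact ⟨y, ⟨v, hv, l', by simpa using hl, h₁⟩, rfl⟩
    · rintro ⟨y, ⟨v, hv, l, hl, h⟩, rfl⟩
      exact ⟨v, hv, l ++ [y], by simp [hl], h.append (singleton y)⟩

end IsWalk

theorem IsPath.exists_isWalk {E0 E1 : Type*} {d r : E1 → E0} {n : ℕ} {p : Fin (n + 1) → E1}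
    (hp : IsPath d r n p) :
    ∃ l : List E1, l.length = n + 1 ∧ IsWalk d r (r (p (Fin.last n))) l (d (p 0)) := by
  induction n with
  | zero => exact ⟨[p 0], rfl, IsWalk.singleton _⟩
  | succ n ih =>
    obtain ⟨l, hl, h⟩ := ih (p := fun i => p i.castSucc) fun i => by
      simpa only [Fin.succ_castSucc] using hp i.castSucc
    refine ⟨p (Fin.last _) :: l, by simp [hl], rfl, ?_⟩
    have := hp (Fin.last n)
    rw [Fin.succ_last] at this
    rw [this]
    exact h

/-- Let `E = (E⁰, E¹, d, r)` be a topologically free topological graph.  Then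
for every open `V ⊆ E⁰` and every positive integer (here `n+1`), either
`(r^{n+1})⁻¹(V) = ∅`, or there exist `m+1 ≥ n+1` and a non-returning path
`p ∈ E^{m+1}` with `r^{m+1}(p) ∈ V`. -/
theorem stmt_18 {E0 E1 : Type*} [TopologicalSpace E0] [TopologicalSpace E1]
    [LocallyCompactSpace E0] [LocallyCompactSpace E1] [T2Space E0] [T2Space E1]
    {d : E1 → E0} (hd : IsLocalHomeomorph d)
    {r : E1 → E0} (hr : Continuous r)
    (htopfree : interior (loopNoEntranceBase d r) = ∅)
    (V : Set E0) (hV : IsOpen V) (n : ℕ) :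
    (∀ p : Fin (n + 1) → E1, IsPath d r n p → r (p (Fin.last n)) ∉ V) ∨
    (∃ m : ℕ, n ≤ m ∧ ∃ p : Fin (m + 1) → E1, IsPath d r m p ∧
      (∀ i : Fin (m + 1), i ≠ 0 → p i ≠ p 0) ∧
      r (p (Fin.last m)) ∈ V) := by
  by_contra! hcon
  obtain ⟨⟨p, hp, hpV⟩, hret⟩ := hcon
  have H : ∀ v ∈ V, ∀ l y w, IsWalk d r v (l ++ [y]) w → n ≤ l.length → y ∈ l := by
    intro v hv l y w h hn
    by_contra hy
    obtain ⟨q, hq, hqr, -, hqy, hmem⟩ := h.exists_isPath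
    refine hret l.length hn q hq (fun i hi he => hy ?_) (hqr ▸ hv)
    rw [← hqy, ← he]
    exact hmem i hi
  obtain ⟨l, hl, h⟩ := hp.exists_isWalk
  have hsub : {w | ∃ v ∈ V, ∃ l : List E1, l.length = n + 1 ∧ IsWalk d r v l w} ⊆
      loopNoEntranceBase d r := by
    rintro w ⟨v, hv, l, hl, h⟩
    exact IsWalk.mem_loopNoEntranceBase H hv hl h
  have hmem : d (p 0) ∈ interior (loopNoEntranceBase d r) :=
    interior_maximal hsub (IsWalk.isOpen_sources hd.isOpenMap hr hV (n + 1)) ⟨_, hpV, l, hl, h⟩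
  rw [htopfree] at hmem
  exact hmem
end
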